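/- Let I be a finite set of natural numbers, let i ∈ I, and let j be a natural number with j ∉ I. Then σ({j},I) · σ((I∪{j})∖{i}, {i}) = σ(I∖{i},{i}) · σ({j}, I∖{i}). (This is the signature identity of Appendix A.3, Equation (A.29), which proves the triple mixed product formula u ⌐ (v ∧ w) = (−1)^r (u·v) w + v ∧ (u ⌐ w) for 1-vectors u, v and an r-vector w.) -/

import Mathlib

/-- Number of "inversion" pairs (a,b) ∈ A × B with b < a. -/
def invCount (A B : Finset ℕ) : ℕ :=
  ((A ×ˢ B).filter (fun p => p.2 < p.1)).card

/-- The signature σ(A,B) = (−1)^{N(A,B)} of the permutation sorting the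
concatenation of the increasing enumerations of A and B. -/
def sortSign (A B : Finset ℕ) : ℤ :=
  (-1) ^ invCount A B

theorem invCount_union_left {A B : Finset ℕ} (h : Disjoint A B) (C : Finset ℕ) :
    invCount (A ∪ B) C = invCount A C + invCount B C := by
  unfold invCount
  rw [Finset.union_product, Finset.filter_union, Finset.card_union_of_disjoint]
  exact Finset.disjoint_filter_filter (Finset.disjoint_product.2 (Or.inl h))

theorem invCount_union_right (A : Finset ℕ) {B C : Finset ℕ} (h : Disjoint B C) :
    invCount A (B ∪ C) = invCount A B + invCount A C := by
  unfold invCount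
  rw [Finset.product_union, Finset.filter_union, Finset.card_union_of_disjoint]
  exact Finset.disjoint_filter_filter (Finset.disjoint_product.2 (Or.inr h))

theorem sortSign_union_left {A B : Finset ℕ} (h : Disjoint A B) (C : Finset ℕ) :
    sortSign (A ∪ B) C = sortSign A C * sortSign B C := by
  simp only [sortSign, invCount_union_left h, pow_add]

theorem sortSign_union_right (A : Finset ℕ) {B C : Finset ℕ} (h : Disjoint B C) :
    sortSign A (B ∪ C) = sortSign A B * sortSign A C := by
  simp only [sortSign, invCount_union_right A h, pow_add]

theorem sortSign_mul_self (A B : Finset ℕ) : sortSign A B * sortSign A B = 1 := by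
  simp only [sortSign, ← mul_pow, neg_mul_neg, one_mul, one_pow]

theorem triple_mixed_product_signature (I : Finset ℕ) (i j : ℕ)
    (hi : i ∈ I) (hj : j ∉ I) :
    sortSign {j} I * sortSign ((I ∪ {j}) \ {i}) {i} =
      sortSign (I \ {i}) {i} * sortSign {j} (I \ {i}) := by
  have hji : j ≠ i := fun h => hj (h ▸ hi)
  have hI : I \ {i} ∪ {i} = I := Finset.sdiff_union_of_subset (by simpa using hi)
  have hIj : (I ∪ {j}) \ {i} = I \ {i} ∪ {j} := by
    rw [Finset.union_sdiff_distrib, Finset.sdiff_eq_self_of_disjoint (Finset.disjoint_singleton.2 hji)]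
  have hdisj : Disjoint (I \ {i}) {j} := by simp [hj]
  have hsplit : sortSign {j} I = sortSign {j} (I \ {i}) * sortSign {j} {i} := by
    rw [← sortSign_union_right {j} Finset.sdiff_disjoint, hI]
  rw [hsplit, hIj, sortSign_union_left hdisj]
  linear_combination
    sortSign (I \ {i}) {i} * sortSign {j} (I \ {i}) * sortSign_mul_self {j} {i}
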